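/- Suppose the discount factor satisfies β < 1/((2−ε)·|p11 − p01|). Then for every horizon T ≥ 1 and all ω, ω' ∈ [0,1], |V_T(ω) − V_T(ω')| ≤ C·|ω − ω'|, where C = (1−ε)/(1 − (2−ε)·β·|p11 − p01|); i.e., every finite-horizon value function V_T is Lipschitz on [0,1] with constant C. -/

import Mathlib

/-- One-step belief update without observation: `T(ω) = ω·p11 + (1−ω)·p01`. -/
noncomputable def Tmap (p01 p11 ω : ℝ) : ℝ := ω * p11 + (1 - ω) * p01

/-- Belief update after a failed observation: `φ(ω) = εω/(εω + 1 − ω)`. -/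
noncomputable def phi (ε ω : ℝ) : ℝ := ε * ω / (ε * ω + 1 - ω)

/-- Finite-horizon value function `V_T` of the single-armed bandit with subsidy `m`:
`V_0 ≡ 0` and `V_T(ω) = max{V_T(ω;u=1), V_T(ω;u=0)}`. -/
noncomputable def Vfin (p01 p11 ε β m : ℝ) : ℕ → ℝ → ℝ
  | 0, _ => 0
  | T + 1, ω =>
      max ((1 - ε) * ω + β * ((1 - ε) * ω * Vfin p01 p11 ε β m T p11
            + (1 - (1 - ε) * ω) * Vfin p01 p11 ε β m T (Tmap p01 p11 (phi ε ω))))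
          (m + β * Vfin p01 p11 ε β m T (Tmap p01 p11 ω))

theorem Tmap_sub (p01 p11 x y : ℝ) :
    Tmap p01 p11 x - Tmap p01 p11 y = (p11 - p01) * (x - y) := by
  unfold Tmap; ring

theorem Tmap_one (p01 p11 : ℝ) : Tmap p01 p11 1 = p11 := by
  unfold Tmap; ring

theorem Tmap_mem_Icc {p01 p11 x : ℝ} (hp01 : p01 ∈ Set.Icc (0:ℝ) 1)
    (hp11 : p11 ∈ Set.Icc (0:ℝ) 1) (hx : x ∈ Set.Icc (0:ℝ) 1) :
    Tmap p01 p11 x ∈ Set.Icc (0:ℝ) 1 :=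
  convex_Icc (0:ℝ) 1 hp11 hp01 hx.1 (sub_nonneg.2 hx.2) (add_sub_cancel x 1)

theorem phi_denom_pos {ε x : ℝ} (hε : 0 < ε) (hx : x ∈ Set.Icc (0:ℝ) 1) :
    0 < ε * x + 1 - x := by
  rcases hx.2.lt_or_eq with h | rfl
  · nlinarith [mul_nonneg hε.le hx.1]
  · linarith

theorem phi_mem_Icc {ε x : ℝ} (hε : 0 < ε) (hx : x ∈ Set.Icc (0:ℝ) 1) :
    phi ε x ∈ Set.Icc (0:ℝ) 1 := by
  have hg := phi_denom_pos hε hx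
  refine ⟨div_nonneg (mul_nonneg hε.le hx.1) hg.le, ?_⟩
  rw [phi, div_le_one hg]
  linarith [hx.2]

/-- If `V` is `K`-Lipschitz on `[0,1]`, then so is the active one-step value, with constant
`(1 - ε) + β |p11 - p01| K`. -/
theorem abs_active_value_sub_le {p01 p11 ε β K : ℝ} {V : ℝ → ℝ}
    (hp01 : p01 ∈ Set.Icc (0:ℝ) 1) (hp11 : p11 ∈ Set.Icc (0:ℝ) 1)
    (hε : ε ∈ Set.Ioo (0:ℝ) 1) (hβ : 0 ≤ β)
    (hV : ∀ x ∈ Set.Icc (0:ℝ) 1, ∀ y ∈ Set.Icc (0:ℝ) 1, |V x - V y| ≤ K * |x - y|)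
    {x y : ℝ} (hx : x ∈ Set.Icc (0:ℝ) 1) (hy : y ∈ Set.Icc (0:ℝ) 1) :
    |((1 - ε) * x + β * ((1 - ε) * x * V p11
          + (1 - (1 - ε) * x) * V (Tmap p01 p11 (phi ε x))))
        - ((1 - ε) * y + β * ((1 - ε) * y * V p11
          + (1 - (1 - ε) * y) * V (Tmap p01 p11 (phi ε y))))|
      ≤ ((1 - ε) + β * |p11 - p01| * K) * |x - y| := by
  have hgx := phi_denom_pos hε.1 hx
  have hgy := phi_denom_pos hε.1 hy
  have hTx := Tmap_mem_Icc hp01 hp11 (phi_mem_Icc hε.1 hx)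
  have hTy := Tmap_mem_Icc hp01 hp11 (phi_mem_Icc hε.1 hy)
  have hsuccess : |V p11 - V (Tmap p01 p11 (phi ε x))|
      ≤ K * (|p11 - p01| * ((1 - x) / (ε * x + 1 - x))) := by
    have h := hV _ hp11 _ hTx
    have hphi : 1 - phi ε x = (1 - x) / (ε * x + 1 - x) := by
      unfold phi; field_simp; ring
    have hsub := Tmap_sub p01 p11 1 (phi ε x)
    rw [Tmap_one] at hsub
    rwa [hsub, hphi, abs_mul,
      abs_of_nonneg (div_nonneg (sub_nonneg.2 hx.2) hgx.le)] at h
  have hfailure : |V (Tmap p01 p11 (phi ε x)) - V (Tmap p01 p11 (phi ε y))|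
      ≤ K * (|p11 - p01| * (ε * |x - y| / ((ε * x + 1 - x) * (ε * y + 1 - y)))) := by
    have h := hV _ hTx _ hTy
    have hphi : phi ε x - phi ε y
        = ε * (x - y) / ((ε * x + 1 - x) * (ε * y + 1 - y)) := by
      unfold phi; field_simp; ring
    rwa [Tmap_sub, hphi, abs_mul, abs_div, abs_mul ε, abs_of_pos hε.1,
      abs_of_pos (mul_pos hgx hgy)] at h
  have ha : 0 ≤ 1 - ε := sub_nonneg.2 hε.2.le
  calc
    _ = |(1 - ε) * (x - y)
          + β * ((1 - ε) * (x - y) * (V p11 - V (Tmap p01 p11 (phi ε x)))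
            + (ε * y + 1 - y)
              * (V (Tmap p01 p11 (phi ε x)) - V (Tmap p01 p11 (phi ε y))))| := by
      congr 1; ring
    _ ≤ (1 - ε) * |x - y|
          + β * ((1 - ε) * |x - y| * |V p11 - V (Tmap p01 p11 (phi ε x))|
            + (ε * y + 1 - y)
              * |V (Tmap p01 p11 (phi ε x)) - V (Tmap p01 p11 (phi ε y))|) := by
      refine (abs_add_le _ _).trans ?_
      rw [abs_mul, abs_of_nonneg ha, abs_mul β, abs_of_nonneg hβ]
      gcongr
      refine (abs_add_le _ _).trans_eq ?_
      rw [abs_mul, abs_mul, abs_mul, abs_of_nonneg ha, abs_of_pos hgy]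
    _ ≤ (1 - ε) * |x - y|
          + β * ((1 - ε) * |x - y| * (K * (|p11 - p01| * ((1 - x) / (ε * x + 1 - x))))
            + (ε * y + 1 - y) * (K * (|p11 - p01|
              * (ε * |x - y| / ((ε * x + 1 - x) * (ε * y + 1 - y)))))) := by
      gcongr
    _ = ((1 - ε) + β * |p11 - p01| * K) * |x - y| := by
      field_simp; ring

/-- Under `β < 1/((2−ε)·|p11 − p01|)`, every finite-horizon value function `V_T`
(`T ≥ 1`) is Lipschitz on `[0,1]` with constant
`C = (1−ε)/(1 − (2−ε)·β·|p11 − p01|)`. -/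
theorem Vfin_lipschitz (p01 p11 ε β m : ℝ)
    (hp01 : p01 ∈ Set.Ioo (0:ℝ) 1) (hp11 : p11 ∈ Set.Ioo (0:ℝ) 1)
    (hne : p01 ≠ p11) (hε : ε ∈ Set.Ioo (0:ℝ) 1) (hβ : β ∈ Set.Ioo (0:ℝ) 1)
    (hβC : β < 1 / ((2 - ε) * |p11 - p01|)) :
    ∀ T : ℕ, 1 ≤ T → ∀ ω ∈ Set.Icc (0:ℝ) 1, ∀ ω' ∈ Set.Icc (0:ℝ) 1,
      |Vfin p01 p11 ε β m T ω - Vfin p01 p11 ε β m T ω'|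
        ≤ ((1 - ε) / (1 - (2 - ε) * β * |p11 - p01|)) * |ω - ω'| := by
  have hd : 0 < |p11 - p01| := abs_pos.2 (sub_ne_zero.2 hne.symm)
  have hden : 0 < 1 - (2 - ε) * β * |p11 - p01| := by
    rw [lt_div_iff₀ (mul_pos (by linarith [hε.2]) hd)] at hβC
    linarith
  set C := (1 - ε) / (1 - (2 - ε) * β * |p11 - p01|)
  have hC0 : 0 ≤ C := div_nonneg (sub_nonneg.2 hε.2.le) hden.le
  have hCeq : C * (1 - (2 - ε) * β * |p11 - p01|) = 1 - ε := div_mul_cancel₀ _ hden.ne'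
  have hactive : (1 - ε) + β * |p11 - p01| * C ≤ C := by
    have := mul_nonneg (sub_nonneg.2 hε.2.le) (mul_nonneg (mul_nonneg hβ.1.le hd.le) hC0)
    linarith
  have hp01' := Set.Ioo_subset_Icc_self hp01
  have hp11' := Set.Ioo_subset_Icc_self hp11
  intro T _
  induction T with
  | zero => omega
  | succ T ih =>
    have hV : ∀ x ∈ Set.Icc (0:ℝ) 1, ∀ y ∈ Set.Icc (0:ℝ) 1,
        |Vfin p01 p11 ε β m T x - Vfin p01 p11 ε β m T y| ≤ C * |x - y| := by
      rcases T.eq_zero_or_pos with rfl | hT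
      · intro x _ y _
        simpa [Vfin] using mul_nonneg hC0 (abs_nonneg (x - y))
      · exact ih hT
    intro x hx y hy
    rw [Vfin, Vfin]
    refine (abs_max_sub_max_le_max _ _ _ _).trans (max_le ?_ ?_)
    · exact (abs_active_value_sub_le hp01' hp11' hε hβ.1.le hV hx hy).trans
        (mul_le_mul_of_nonneg_right hactive (abs_nonneg _))
    · have h := hV _ (Tmap_mem_Icc hp01' hp11' hx) _ (Tmap_mem_Icc hp01' hp11' hy)
      rw [Tmap_sub, abs_mul] at h
      rw [add_sub_add_left_eq_sub, ← mul_sub, abs_mul, abs_of_pos hβ.1]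
      calc
        _ ≤ β * (C * (|p11 - p01| * |x - y|)) := mul_le_mul_of_nonneg_left h hβ.1.le
        _ = (β * |p11 - p01| * C) * |x - y| := by ring
        _ ≤ C * |x - y| :=
          mul_le_mul_of_nonneg_right (by linarith [hε.2]) (abs_nonneg _)
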